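/- arXiv:2404.04610 — 2 statements merged into one kernel-verified Lean document; each statement's English description precedes it below -/
import Mathlib

section
/- Let R be a u-S-Noetherian commutative ring where S is a multiplicative subset of R consisting of nonzerodivisors, and let T be a multiplicative subset of R such that 0 ∉ sT for each s ∈ S. If M is an S-torsion-free u-S-injective R-module, then the localization M_T is a u-S_T-injective R_T-module, where S_T = {s/t : s ∈ S, t ∈ T} is the image multiplicative subset of R_T. -/
open CategoryTheory

universe u

/-- The `n`-th Ext group of two `A`-modules, as an `A`-module. -/
noncomputable def extMod (A : Type u) [CommRing A] (n : ℕ) (M N : ModuleCat.{u} A) :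
    ModuleCat A :=
  ((Ext A (ModuleCat.{u} A) n).obj (Opposite.op M)).obj N

universe v

lemma HomologicalComplex.exists_d_eq_smul_of_smul_homology_eq_zero {A : Type u} [CommRing A]
    {ι : Type*} {c : ComplexShape ι} (K : HomologicalComplex (ModuleCat.{u} A) c)
    {i j k : ι} (hi : c.prev j = i) (hk : c.next j = k) (r : A)
    (h : ∀ x : K.homology j, r • x = 0) (y : K.X j) (hy : K.d j k y = 0) :
    ∃ g : K.X i, K.d i j g = r • y := by
  let l : ModuleCat.of A A ⟶ K.X j := ModuleCat.ofHom (LinearMap.toSpanSingleton A _ y)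
  have hl : l ≫ K.d j k = 0 := by
    ext
    simp [l, hy]
  let z : K.cycles j := K.liftCycles l k hk hl (1 : A)
  have hz : K.iCycles j z = y := by
    have : K.iCycles j z = l (1 : A) := congr($(K.liftCycles_i l k hk hl) (1 : A))
    rw [this]
    exact one_smul A y
  have hex : (ShortComplex.mk _ _ (K.toCycles_comp_homologyπ i j)).Exact :=
    ShortComplex.exact_of_g_is_cokernel _ (K.homologyIsCokernel i j hi)
  rw [ShortComplex.moduleCat_exact_iff] at hex
  obtain ⟨g, hg⟩ := hex (r • z) (by
    rw [map_smul]
    exact h _)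
  refine ⟨g, ?_⟩
  rw [← hz, ← map_smul, ← hg]
  exact (congr($(K.toCycles_i i j) g)).symm

/-- If `r` kills `Ext¹(N, M)`, then `r` times any `1`-cocycle of a projective resolution is a
coboundary. -/
lemma exists_comp_eq_smul_of_smul_extMod_eq_zero {A : Type u} [CommRing A]
    {N M : ModuleCat.{u} A} (P : ProjectiveResolution N) (r : A)
    (h : ∀ x : extMod A 1 N M, r • x = 0)
    (f : P.complex.X 1 ⟶ M) (hf : P.complex.d 2 1 ≫ f = 0) :
    ∃ g : P.complex.X 0 ⟶ M, P.complex.d 1 0 ≫ g = r • f := by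
  have e := P.isoExt (R := A) 1 M
  refine (P.complex.linearYonedaObj A M).exists_d_eq_smul_of_smul_homology_eq_zero
    (i := 0) (k := 2) (by simp) (by simp) r ?_ f hf
  intro x
  have hx : e.hom (e.inv x) = x := congr($(e.inv_hom_id) x)
  rw [← hx, ← map_smul]
  exact (congrArg e.hom (h (e.inv x))).trans (map_zero e.hom.hom)

lemma extMod_one_eq_zero_of_injective {A : Type u} [CommRing A]
    (N M : ModuleCat.{u} A) [Injective M] (x : extMod A 1 N M) : x = 0 := by
  obtain ⟨P⟩ := (inferInstance : HasProjectiveResolution N).out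
  have e := P.isoExt (R := A) 1 M
  have hex : (P.complex.linearYonedaObj A M).ExactAt 1 := by
    rw [HomologicalComplex.exactAt_iff' _ 0 1 2 (by simp) (by simp),
      ShortComplex.moduleCat_exact_iff]
    intro (f : P.complex.X 1 ⟶ M) (hf : P.complex.d 2 1 ≫ f = 0)
    exact ⟨(P.exact_succ 0).descToInjective f hf, (P.exact_succ 0).comp_descToInjective f hf⟩
  rw [HomologicalComplex.exactAt_iff_isZero_homology] at hex
  have : Subsingleton (extMod A 1 N M) := ModuleCat.subsingleton_of_isZero (hex.of_iso e)
  exact Subsingleton.elim _ _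

/-- If `r` kills `Ext¹(B ⧸ C, M)`, then `r` times any linear map `C → M` extends to `B`. -/
lemma exists_extension_of_smul_extMod_eq_zero {A : Type u} [CommRing A]
    {B : Type u} [AddCommGroup B] [Module A B] (C : Submodule A B)
    (M : Type u) [AddCommGroup M] [Module A M] (r : A)
    (h : ∀ x : extMod A 1 (ModuleCat.of A (B ⧸ C)) (ModuleCat.of A M), r • x = 0)
    (f : C →ₗ[A] M) : ∃ g : B →ₗ[A] M, ∀ c : C, g c = r • f c := by
  obtain ⟨P⟩ := (inferInstance : HasProjectiveResolution (ModuleCat.of A (B ⧸ C))).out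
  let π : P.complex.X 0 →ₗ[A] B ⧸ C := (P.π.f 0).hom
  have hπ : Function.Surjective π := (ModuleCat.epi_iff_surjective (P.π.f 0)).1 inferInstance
  let d₁ := (P.complex.d 1 0).hom
  let d₂ := (P.complex.d 2 1).hom
  have hd₁ : ∀ x, π x = 0 → ∃ y, d₁ y = x :=
    (ShortComplex.moduleCat_exact_iff _).1 P.exact₀
  have hπd (y) : π (d₁ y) = 0 := congr($(P.complex_d_comp_π_f_zero) y)
  have hdd (y) : d₁ (d₂ y) = 0 := congr($(P.complex.d_comp_d 2 1 0) y)
  have : Module.Projective A (P.complex.X 0) :=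
    (IsProjective.iff_projective _).2 (P.projective 0)
  obtain ⟨p, hp⟩ := Module.projective_lifting_property C.mkQ π C.mkQ_surjective
  have hp' (x) : C.mkQ (p x) = π x := congr($hp x)
  let c : P.complex.X 1 →ₗ[A] C := (p ∘ₗ d₁).codRestrict C fun y => 
    (Submodule.Quotient.mk_eq_zero C).1 ((hp' (d₁ y)).trans (hπd y))
  have hc (y) : (c y : B) = p (d₁ y) := rfl
  obtain ⟨g, hg⟩ := exists_comp_eq_smul_of_smul_extMod_eq_zero P r h
    (ModuleCat.ofHom (f ∘ₗ c)) (by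
      ext y
      have : c (d₂ y) = 0 := Subtype.ext (by rw [hc, hdd, map_zero]; rfl)
      change f (c (d₂ y)) = 0
      rw [this, map_zero])
  have hg' (y) : g.hom (d₁ y) = r • f (c y) := congr($hg y)
  let φ : C × P.complex.X 0 →ₗ[A] B := C.subtype.coprod p
  let ψ : C × P.complex.X 0 →ₗ[A] M := (r • f).coprod g.hom
  have hφ : Function.Surjective φ := by
    intro b
    obtain ⟨x, hx⟩ := hπ (C.mkQ b)
    have hb : b - p x ∈ C := by
      refine (Submodule.Quotient.mk_eq_zero C).1 ?_
      change C.mkQ (b - p x) = 0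
      rw [map_sub, hp', hx, sub_self]
    exact ⟨(⟨b - p x, hb⟩, x), by simp [φ]⟩
  have hker : LinearMap.ker φ ≤ LinearMap.ker ψ := by
    rintro ⟨a, x⟩ hax
    have hax : (a : B) + p x = 0 := by simpa [φ] using hax
    obtain ⟨y, rfl⟩ := hd₁ x (by
      rw [← hp', ← neg_eq_of_add_eq_zero_right hax, C.mkQ_apply,
        Submodule.Quotient.mk_eq_zero]
      exact C.neg_mem a.2)
    have : a + c y = 0 := Subtype.ext hax
    have h0 : ψ (a, d₁ y) = r • f (a + c y) := by simp [ψ, hg']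
    rw [LinearMap.mem_ker, h0, this, map_zero, smul_zero]
  refine ⟨(LinearMap.ker φ).liftQ ψ hker ∘ₗ (φ.quotKerEquivOfSurjective hφ).symm, fun a => ?_⟩
  have : (φ.quotKerEquivOfSurjective hφ).symm (a : B) =
      Submodule.Quotient.mk (a, (0 : P.complex.X 0)) := by
    rw [LinearEquiv.symm_apply_eq]
    simp [φ]
  simp [this, ψ]

/-- If every ideal of `R` is `S`-finite, then the localization of `R` at `S` is Noetherian. -/
lemma Localization.isNoetherianRing_of_forall_ideal_exists_fg {R : Type*} [CommRing R]
    (S : Submonoid R)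
    (h : ∀ I : Ideal R, ∃ J : Ideal R, J.FG ∧ J ≤ I ∧ ∀ x ∈ I, ∃ s ∈ S, s * x ∈ J) :
    IsNoetherianRing (Localization S) := by
  rw [isNoetherianRing_iff_ideal_fg]
  intro I
  obtain ⟨J, hJ, hJI, hs⟩ := h (I.comap (algebraMap R (Localization S)))
  have hIJ : I = J.map (algebraMap R (Localization S)) := by
    refine le_antisymm ?_ (Ideal.map_le_iff_le_comap.2 hJI)
    rw [← IsLocalization.map_under S (Localization S) I, Ideal.map_le_iff_le_comap]
    intro x hx
    obtain ⟨s, hsS, hsx⟩ := hs x (by simpa using hx)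
    have := Ideal.mem_map_of_mem (algebraMap R (Localization S)) hsx
    rw [map_mul] at this
    exact (Ideal.unit_mul_mem_iff_mem _
      (IsLocalization.map_units (Localization S) ⟨s, hsS⟩)).1 this
  rw [hIJ]
  exact hJ.map _

lemma Submodule.exists_fg_le_forall_smul_mem {R : Type*} [CommRing R] (S : Submonoid R)
    [IsNoetherianRing (Localization S)] {P : Type*} [AddCommGroup P] [Module R P]
    [Module.Finite R P] (K : Submodule R P) :
    ∃ K₀ ≤ K, K₀.FG ∧ ∀ x ∈ K, ∃ s ∈ S, s • x ∈ K₀ := by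
  classical
  let f := LocalizedModule.mkLinearMap S P
  have : Module.Finite (Localization S) (LocalizedModule S P) :=
    Module.Finite.of_isLocalizedModule S f
  have hfg : (Submodule.span (Localization S) (f '' (K : Set P))).FG := IsNoetherian.noetherian _
  obtain ⟨t, htK, ht⟩ := (Submodule.fg_span_iff_fg_span_finset_subset _).1 hfg
  obtain ⟨u, huK, rfl⟩ := Finset.subset_set_image_iff.1 htK
  refine ⟨span R u, span_le.2 huK, ⟨u, rfl⟩, fun x hx => ?_⟩
  have hx' : f x ∈ (span R (u : Set P)).localized' (Localization S) S f := by
    rw [localized'_span, ← Finset.coe_image, ← ht]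
    exact subset_span ⟨x, hx, rfl⟩
  obtain ⟨m, hm, s, hms⟩ := hx'
  rw [IsLocalizedModule.mk'_eq_iff, Submonoid.smul_def, ← map_smul] at hms
  obtain ⟨c, hc⟩ := IsLocalizedModule.exists_of_eq (S := S) hms
  refine ⟨c * s, S.mul_mem c.2 s.2, ?_⟩
  rw [mul_smul]
  simp only [Submonoid.smul_def] at hc
  rw [← hc]
  exact Submodule.smul_mem _ _ hm

lemma Module.Injective.exists_comp_eq_of_ker_le {R : Type*} [CommRing R] [Small.{v} R]
    {M : Type v} [AddCommGroup M] [Module R M] [Module.Injective R M]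
    {P N : Type*} [AddCommGroup P] [Module R P] [AddCommGroup N] [Module R N]
    (q : P →ₗ[R] N) (g : P →ₗ[R] M) (h : LinearMap.ker q ≤ LinearMap.ker g) :
    ∃ k : N →ₗ[R] M, ∀ x, k (q x) = g x := by
  obtain ⟨k, hk⟩ := Module.Injective.extension_property R M (P ⧸ LinearMap.ker q) N
    ((LinearMap.ker q).liftQ q le_rfl) (LinearMap.ker_eq_bot.1 (Submodule.ker_liftQ_eq_bot' _ _ rfl))
    ((LinearMap.ker q).liftQ g h)
  exact ⟨k, fun x => by simpa using congr($hk (Submodule.Quotient.mk x))⟩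

lemma LocalizedModule.eq_zero_of_smul_eq_zero_of_torsionFree {R : Type*} [CommRing R] {r : R}
    (T : Submonoid R) {M : Type*} [AddCommGroup M] [Module R M]
    (h : ∀ m : M, r • m = 0 → m = 0) (x : LocalizedModule T M) (hx : r • x = 0) : x = 0 := by
  obtain ⟨⟨m, t⟩, rfl⟩ :=
    IsLocalizedModule.mk'_surjective T (LocalizedModule.mkLinearMap T M) x
  simp only [Function.uncurry_apply_pair] at hx ⊢
  rw [← IsLocalizedModule.mk'_smul, IsLocalizedModule.mk'_eq_zero'] at hx
  obtain ⟨c, hc⟩ := hx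
  rw [IsLocalizedModule.mk'_eq_zero']
  exact ⟨c, h _ (by rw [smul_comm, hc])⟩

/-- If every ideal of `R` is `S`-finite and `M` is injective and `S`-torsion-free, then any
localization of `M` satisfies Baer's criterion. -/
lemma LocalizedModule.baer_of_injective {R : Type*} [CommRing R] [Small.{v} R]
    (S T : Submonoid R)
    (h : ∀ I : Ideal R, ∃ J : Ideal R, J.FG ∧ J ≤ I ∧ ∀ x ∈ I, ∃ s ∈ S, s * x ∈ J)
    (M : Type v) [AddCommGroup M] [Module R M] [Module.Injective R M]
    (htf : ∀ s ∈ S, ∀ m : M, s • m = 0 → m = 0) :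
    Module.Baer (Localization T) (LocalizedModule T M) := by
  intro I f
  have := Localization.isNoetherianRing_of_forall_ideal_exists_fg S h
  let a := algebraMap R (Localization T)
  let μ := LocalizedModule.mkLinearMap T M
  let f₀ : I.comap a →ₗ[R] LocalizedModule T M :=
    { toFun := fun x => f ⟨a x, x.2⟩
      map_add' := fun x y => by
        rw [← map_add]
        exact congrArg f (Subtype.ext (map_add a _ _))
      map_smul' := fun r x => by
        rw [RingHom.id_apply, ← algebraMap_smul (Localization T) r (f _), ← map_smul]
        exact congrArg f (Subtype.ext (map_mul a _ _)) }
  obtain ⟨J, hJ, hJI, hIJ⟩ := h (I.comap a)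
  have : Module.Finite R J := Module.Finite.iff_fg.2 hJ
  obtain ⟨n, π, hπ⟩ := Module.Finite.exists_fin' R J
  obtain ⟨K, hK, hKfg, hKs⟩ := (LinearMap.ker π).exists_fg_le_forall_smul_mem S
  let q : ((Fin n → R) ⧸ K) →ₗ[R] J := K.liftQ π hK
  have : Module.FinitePresentation R ((Fin n → R) ⧸ K) :=
    Module.finitePresentation_of_surjective K.mkQ K.mkQ_surjective (by rwa [K.ker_mkQ])
  obtain ⟨g, t, hg⟩ := Module.FinitePresentation.exists_lift_of_isLocalizedModule T μ
    (f₀ ∘ₗ Submodule.inclusion hJI ∘ₗ q)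
  obtain ⟨k, hk⟩ := Module.Injective.exists_comp_eq_of_ker_le (J.subtype ∘ₗ q) g (by
    intro x hx
    obtain ⟨v, rfl⟩ := K.mkQ_surjective x
    have hv : v ∈ LinearMap.ker π := by simpa [q] using hx
    obtain ⟨s, hs, hsv⟩ := hKs v hv
    refine htf s hs _ ?_
    rw [← map_smul, ← map_smul, K.mkQ_apply, (Submodule.Quotient.mk_eq_zero K).2 hsv, map_zero])
  have hkJ (x : R) (hx : x ∈ J) : μ (k x) = t • f₀ ⟨x, hJI hx⟩ := by
    obtain ⟨v, hv⟩ := hπ ⟨x, hx⟩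
    have h₁ := hk (K.mkQ v)
    have h₂ := congr($hg (K.mkQ v))
    have hq : q (K.mkQ v) = ⟨x, hx⟩ := by simp [q, hv]
    simp only [LinearMap.comp_apply, hq, LinearMap.smul_apply] at h₁ h₂
    rw [show k x = g (K.mkQ v) from h₁, h₂]
    rfl
  have hkI (x : R) (hx : x ∈ I.comap a) : x • μ (k 1) = t • f₀ ⟨x, hx⟩ := by
    obtain ⟨s, hs, hsx⟩ := hIJ x hx
    rw [← sub_eq_zero]
    refine eq_zero_of_smul_eq_zero_of_torsionFree T (htf s hs) _ ?_
    rw [smul_sub, sub_eq_zero, ← map_smul, ← map_smul, ← map_smul, ← map_smul, smul_eq_mul,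
      smul_eq_mul, mul_one, hkJ _ hsx, smul_comm s t, ← map_smul f₀ s]
    rfl
  obtain ⟨m, hm⟩ : ∃ m, t • m = μ (k 1) :=
    ⟨_, IsLocalizedModule.mk'_cancel' μ (k 1) t⟩
  refine ⟨LinearMap.toSpanSingleton _ _ m, fun y hy => ?_⟩
  obtain ⟨x, u, rfl⟩ := IsLocalization.exists_mk'_eq T y
  have hx : x ∈ I.comap a := by
    rw [Ideal.mem_comap, ← IsLocalization.mk'_spec _ x u]
    exact I.mul_mem_right _ hy
  apply IsLocalizedModule.smul_injective μ u
  apply IsLocalizedModule.smul_injective μ t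
  have h₁ : u • f ⟨_, hy⟩ = f₀ ⟨x, hx⟩ := by
    rw [Submonoid.smul_def, ← algebraMap_smul (Localization T) (u : R) (f _), ← map_smul]
    exact congrArg f (Subtype.ext (IsLocalization.mk'_spec' _ x u))
  have h₂ : u • (IsLocalization.mk' (Localization T) x u • m) = x • m := by
    rw [Submonoid.smul_def, ← algebraMap_smul (Localization T) (u : R), smul_smul,
      IsLocalization.mk'_spec', algebraMap_smul]
  simp only [LinearMap.toSpanSingleton_apply]
  rw [h₁, h₂, ← hkI x hx, ← hm, smul_comm]

/-- A `u`-`S`-injective `S`-torsion-free module is `S`-divisible. -/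
lemma exists_smul_eq_of_uS_injective {R : Type u} [CommRing R] (S : Submonoid R)
    (hreg : ∀ s ∈ S, ∀ r : R, s * r = 0 → r = 0)
    (M : Type u) [AddCommGroup M] [Module R M]
    (htf : ∀ s ∈ S, ∀ m : M, s • m = 0 → m = 0)
    (hinj : ∀ N : ModuleCat.{u} R, ∃ s ∈ S,
      ∀ x : extMod R 1 N (ModuleCat.of R M), s • x = 0)
    {s : R} (hs : s ∈ S) (m : M) : ∃ m', s • m' = m := by
  let ι := Algebra.linearMap R (Localization S)
  have hι : Function.Injective ι := IsLocalization.injective _ fun s hs =>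
    mem_nonZeroDivisors_iff.2 ⟨fun r hr => hreg s hs r hr,
      fun r hr => hreg s hs r (by rwa [mul_comm])⟩
  obtain ⟨c, hc, hext⟩ := hinj (ModuleCat.of R (Localization S ⧸ LinearMap.range ι))
  let e := LinearEquiv.ofInjective ι hι
  obtain ⟨g, hg⟩ := exists_extension_of_smul_extMod_eq_zero (LinearMap.range ι) M c hext
    (LinearMap.toSpanSingleton R M m ∘ₗ e.symm)
  have h₁ : g (ι 1) = c • m := by
    have := hg (e 1)
    rwa [LinearMap.comp_apply, LinearEquiv.coe_coe, e.symm_apply_apply,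
      LinearMap.toSpanSingleton_apply, one_smul] at this
  let w : Localization S := IsLocalization.mk' _ 1 (⟨c * s, S.mul_mem hc hs⟩ : S)
  have hw : (c * s) • w = ι 1 := by
    rw [Algebra.smul_def]
    exact IsLocalization.mk'_spec' _ 1 (⟨c * s, S.mul_mem hc hs⟩ : S)
  refine ⟨g w, ?_⟩
  rw [← sub_eq_zero]
  refine htf c hc _ ?_
  rw [smul_sub, ← h₁, ← hw, map_smul, mul_smul, sub_self]

/-- A `u`-`S`-injective `S`-torsion-free module is injective. -/
lemma injective_of_uS_injective {R : Type u} [CommRing R] (S : Submonoid R)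
    (hreg : ∀ s ∈ S, ∀ r : R, s * r = 0 → r = 0)
    (M : Type u) [AddCommGroup M] [Module R M]
    (htf : ∀ s ∈ S, ∀ m : M, s • m = 0 → m = 0)
    (hinj : ∀ N : ModuleCat.{u} R, ∃ s ∈ S,
      ∀ x : extMod R 1 N (ModuleCat.of R M), s • x = 0) :
    Module.Injective R M := by
  refine Module.Baer.injective fun I f => ?_
  obtain ⟨s, hs, hext⟩ := hinj (ModuleCat.of R (R ⧸ I))
  obtain ⟨g, hg⟩ := exists_extension_of_smul_extMod_eq_zero I M s hext f
  obtain ⟨m, hm⟩ := exists_smul_eq_of_uS_injective S hreg M htf hinj hs (g 1)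
  refine ⟨LinearMap.toSpanSingleton R M m, fun x hx => ?_⟩
  rw [← sub_eq_zero]
  refine htf s hs _ ?_
  rw [smul_sub, LinearMap.toSpanSingleton_apply, smul_comm, hm, ← map_smul, smul_eq_mul, mul_one,
    ← hg ⟨x, hx⟩, sub_self]

/-- Let `R` be a `u`-`S`-Noetherian commutative ring, where `S` consists of
nonzerodivisors, and `T` a multiplicative subset with `0 ∉ sT` for each `s ∈ S`.
If `M` is an `S`-torsion-free `u`-`S`-injective `R`-module, then `M_T` is a
`u`-`S_T`-injective `R_T`-module, where `S_T` is the image of `S` in `R_T`. -/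
theorem localization_uS_injective_of_S_torsionFree
    (R : Type u) [CommRing R] (S T : Submonoid R)
    (hreg : ∀ s ∈ S, ∀ r : R, s * r = 0 → r = 0)
    (hT : ∀ s ∈ S, ∀ t ∈ T, s * t ≠ 0)
    -- `R` is `u`-`S`-Noetherian
    (huSN : ∃ s ∈ S, ∀ I : Ideal R, ∃ J : Ideal R, J.FG ∧ J ≤ I ∧ ∀ x ∈ I, s * x ∈ J)
    (M : Type u) [AddCommGroup M] [Module R M]
    -- `M` is `S`-torsion-free
    (htf : ∀ s ∈ S, ∀ m : M, s • m = 0 → m = 0)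
    -- `M` is `u`-`S`-injective
    (hinj : ∀ N : ModuleCat.{u} R, ∃ s ∈ S,
      ∀ x : extMod R 1 N (ModuleCat.of R M), s • x = 0) :
    -- `M_T` is `u`-`S_T`-injective over `R_T`
    ∀ N' : ModuleCat.{u} (Localization T),
      ∃ σ ∈ S.map (algebraMap R (Localization T)),
        ∀ x : extMod (Localization T) 1 N'
          (ModuleCat.of (Localization T) (LocalizedModule T M)), σ • x = 0 := by
  intro N'
  have := injective_of_uS_injective S hreg M htf hinj
  obtain ⟨s, hs, huSN⟩ := huSN
  have hbaer := LocalizedModule.baer_of_injective S T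
    (fun I => (huSN I).imp fun J ⟨hJ, hJI, h⟩ => ⟨hJ, hJI, fun x hx => ⟨s, hs, h x hx⟩⟩) M htf
  have := hbaer.injective
  have : Injective (ModuleCat.of (Localization T) (LocalizedModule T M)) :=
    Module.injective_object_of_injective_module _ _
  refine ⟨1, one_mem _, fun x => ?_⟩
  rw [extMod_one_eq_zero_of_injective _ _ x, smul_zero]
end

section
/- Let R be a commutative ring, S a multiplicative subset of R, and E an R-module. Then every short exact sequence 0 → E → B → C → 0 of R-modules beginning with E is u-S-pure if and only if there exists an element s ∈ S such that s·Ext¹_R(N, E) = 0 for every finitely presented R-module N. -/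
open CategoryTheory TensorProduct

universe u

/-- A short exact sequence `0 → A →f B →g C → 0` is `u`-`S`-pure if for every `R`-module
`M` the induced sequence `0 → M ⊗ A → M ⊗ B → M ⊗ C → 0` is `u`-`S`-exact. -/
def IsUSPure (R : Type u) [CommRing R] (S : Submonoid R) {A B C : Type u}
    [AddCommGroup A] [Module R A] [AddCommGroup B] [Module R B]
    [AddCommGroup C] [Module R C] (f : A →ₗ[R] B) (g : B →ₗ[R] C) : Prop :=
  ∀ (M : Type u) [AddCommGroup M] [Module R M],
    -- u-S-exact at M ⊗ A
    (∃ s ∈ S, ∀ x : M ⊗[R] A, LinearMap.lTensor M f x = 0 → s • x = 0) ∧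
    -- u-S-exact at M ⊗ B
    (∃ s ∈ S,
      (∀ x ∈ LinearMap.ker (LinearMap.lTensor M g),
        s • x ∈ LinearMap.range (LinearMap.lTensor M f)) ∧
      (∀ x ∈ LinearMap.range (LinearMap.lTensor M f),
        s • x ∈ LinearMap.ker (LinearMap.lTensor M g))) ∧
    -- u-S-exact at M ⊗ C
    (∃ s ∈ S, ∀ y : M ⊗[R] C, ∃ x : M ⊗[R] B, s • y = LinearMap.lTensor M g x)

section LinearMapFactorization

variable {R A B C : Type*} [Ring R] [AddCommGroup A] [Module R A] [AddCommGroup B] [Module R B]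
  [AddCommGroup C] [Module R C]

theorem LinearMap.exists_comp_eq_of_forall_mem_range {f : A →ₗ[R] B} (hf : Function.Injective f)
    (h : C →ₗ[R] B) (hh : ∀ x, h x ∈ range f) : ∃ k : C →ₗ[R] A, f ∘ₗ k = h :=
  ⟨(LinearEquiv.ofInjective f hf).symm ∘ₗ h.codRestrict (range f) hh, by
    ext x
    exact congr_arg Subtype.val
      ((LinearEquiv.ofInjective f hf).apply_symm_apply (h.codRestrict (range f) hh x))⟩

theorem LinearMap.exists_comp_eq_of_ker_le {f : A →ₗ[R] B} (hf : Function.Surjective f)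
    (h : A →ₗ[R] C) (hh : ker f ≤ ker h) : ∃ k : B →ₗ[R] C, k ∘ₗ f = h :=
  ⟨(ker f).liftQ h hh ∘ₗ (f.quotKerEquivOfSurjective hf).symm, by
    ext x
    have : (f.quotKerEquivOfSurjective hf).symm (f x) = (ker f).mkQ x := by
      rw [LinearEquiv.symm_apply_eq]; rfl
    simp [this]⟩

end LinearMapFactorization

section Ext

variable {R : Type u} [CommRing R]

theorem CategoryTheory.ShortComplex.moduleCat_forall_smul_homology_eq_zero_iff
    (K : ShortComplex (ModuleCat.{u} R)) (s : R) :
    (∀ x : K.homology, s • x = 0) ↔ ∀ h : K.X₂, K.g h = 0 → ∃ k : K.X₁, K.f k = s • h := by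
  let e := K.moduleCatHomologyIso.toLinearEquiv
  have h₁ : (∀ x : K.homology, s • x = 0) ↔
      ∀ x : LinearMap.ker K.g.hom ⧸ LinearMap.range K.moduleCatToCycles, s • x = 0 :=
    ⟨fun h x => e.symm.injective ((map_smul e.symm s x).trans
        ((h (e.symm x)).trans (map_zero e.symm).symm)),
      fun h x => e.injective ((map_smul e s x).trans ((h (e x)).trans (map_zero e).symm))⟩
  rw [h₁, (Submodule.mkQ_surjective _).forall, Subtype.forall]
  refine forall₂_congr fun x hx => ?_
  rw [← map_smul, Submodule.mkQ_apply, Submodule.Quotient.mk_eq_zero, LinearMap.mem_range]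
  exact exists_congr fun k => Subtype.ext_iff

variable {N E : Type u} [AddCommGroup N] [Module R N] [AddCommGroup E] [Module R E]

theorem forall_smul_extMod_one_eq_zero_iff (P : ProjectiveResolution (ModuleCat.of R N)) (s : R) :
    (∀ x : extMod R 1 (ModuleCat.of R N) (ModuleCat.of R E), s • x = 0) ↔
    ∀ h : P.complex.X 1 →ₗ[R] E, h ∘ₗ (P.complex.d 2 1).hom = 0 →
      ∃ k : P.complex.X 0 →ₗ[R] E, k ∘ₗ (P.complex.d 1 0).hom = s • h := by
  let K := P.complex.linearYonedaObj R (ModuleCat.of R E)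
  let e := (P.isoExt (R := R) 1 (ModuleCat.of R E) ≪≫
    K.homologyIsoSc' 0 1 2 (by simp) (by simp)).toLinearEquiv
  have h₁ : (∀ x : extMod R 1 (ModuleCat.of R N) (ModuleCat.of R E), s • x = 0) ↔
      ∀ x : (K.sc' 0 1 2).homology, s • x = 0 :=
    ⟨fun h x => e.symm.injective ((map_smul e.symm s x).trans
        ((h (e.symm x)).trans (map_zero e.symm).symm)),
      fun h x => e.injective ((map_smul e s x).trans ((h (e x)).trans (map_zero e).symm))⟩
  rw [h₁, ShortComplex.moduleCat_forall_smul_homology_eq_zero_iff]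
  constructor
  · intro H h hh
    obtain ⟨k, hk⟩ := H (ModuleCat.ofHom h) (ModuleCat.hom_ext hh)
    exact ⟨k.hom, congr_arg ModuleCat.Hom.hom hk⟩
  · intro H h hh
    obtain ⟨k, hk⟩ := H h.hom (congr_arg ModuleCat.Hom.hom hh)
    exact ⟨ModuleCat.ofHom k, ModuleCat.hom_ext hk⟩

variable {B C : Type u} [AddCommGroup B] [Module R B] [AddCommGroup C] [Module R C]
  {f : E →ₗ[R] B} {g : B →ₗ[R] C}

theorem CategoryTheory.ProjectiveResolution.moduleCat_surjective_π
    (P : ProjectiveResolution (ModuleCat.of R N)) : Function.Surjective (P.π.f 0).hom :=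
  (ModuleCat.epi_iff_surjective _).mp inferInstance

theorem CategoryTheory.ProjectiveResolution.moduleCat_exact_d_π
    (P : ProjectiveResolution (ModuleCat.of R N)) :
    Function.Exact (P.complex.d 1 0).hom (P.π.f 0).hom :=
  (ShortComplex.ShortExact.moduleCat_exact_iff_function_exact _).mp P.exact₀

theorem CategoryTheory.ProjectiveResolution.moduleCat_exact_d_d
    (P : ProjectiveResolution (ModuleCat.of R N)) :
    Function.Exact (P.complex.d 2 1).hom (P.complex.d 1 0).hom :=
  (ShortComplex.ShortExact.moduleCat_exact_iff_function_exact _).mp (P.exact_succ 0)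

theorem exists_lift_smul_of_smul_extMod_one_eq_zero (hf : Function.Injective f)
    (hg : Function.Surjective g) (hfg : Function.Exact f g) {s : R}
    (hs : ∀ x : extMod R 1 (ModuleCat.of R N) (ModuleCat.of R E), s • x = 0) (φ : N →ₗ[R] C) :
    ∃ ψ : N →ₗ[R] B, g ∘ₗ ψ = s • φ := by
  let P := ProjectiveResolution.of (ModuleCat.of R N)
  let d := (P.complex.d 1 0).hom
  let π : P.complex.X 0 →ₗ[R] N := (P.π.f 0).hom
  have hπ : Function.Surjective π := P.moduleCat_surjective_π
  have hdπ : Function.Exact d π := P.moduleCat_exact_d_π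
  have hdd : Function.Exact (P.complex.d 2 1).hom d := P.moduleCat_exact_d_d
  have : Module.Projective R (P.complex.X 0) :=
    (IsProjective.iff_projective _).mpr (P.projective 0)
  obtain ⟨ψ, hψ⟩ := Module.projective_lifting_property g (φ ∘ₗ π) hg
  have hψ' x : g (ψ x) = φ (π x) := LinearMap.congr_fun hψ x
  obtain ⟨h, hh⟩ := LinearMap.exists_comp_eq_of_forall_mem_range hf (ψ ∘ₗ d) fun x =>
    (hfg _).mp (by simp [hψ', hdπ.apply_apply_eq_zero])
  have hh' x : f (h x) = ψ (d x) := LinearMap.congr_fun hh x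
  obtain ⟨k, hk⟩ := (forall_smul_extMod_one_eq_zero_iff P s).mp hs h <| LinearMap.ext fun x =>
    hf (by simp [hh', hdd.apply_apply_eq_zero])
  have hk' x : k (d x) = s • h x := LinearMap.congr_fun hk x
  obtain ⟨θ, hθ⟩ := LinearMap.exists_comp_eq_of_ker_le hπ (s • ψ - f ∘ₗ k) fun x hx => by
    obtain ⟨y, rfl⟩ := (hdπ x).mp hx
    simp [hk', hh']
  refine ⟨θ, LinearMap.ext fun n => ?_⟩
  obtain ⟨x, rfl⟩ := hπ n
  have hθ' : θ (π x) = s • ψ x - f (k x) := LinearMap.congr_fun hθ x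
  simp [hθ', hψ', hfg.apply_apply_eq_zero]

theorem smul_extMod_one_eq_zero_of_exists_lift_smul [Module.Injective R B]
    (hf : Function.Injective f) (hfg : Function.Exact f g) {s : R}
    (hs : ∀ φ : N →ₗ[R] C, ∃ ψ : N →ₗ[R] B, g ∘ₗ ψ = s • φ)
    (x : extMod R 1 (ModuleCat.of R N) (ModuleCat.of R E)) : s • x = 0 := by
  let P := ProjectiveResolution.of (ModuleCat.of R N)
  let d := (P.complex.d 1 0).hom
  let π : P.complex.X 0 →ₗ[R] N := (P.π.f 0).hom
  have hπ : Function.Surjective π := P.moduleCat_surjective_π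
  have hdπ : Function.Exact d π := P.moduleCat_exact_d_π
  have hdd : Function.Exact (P.complex.d 2 1).hom d := P.moduleCat_exact_d_d
  refine (forall_smul_extMod_one_eq_zero_iff P s).mpr (fun h hh => ?_) x
  obtain ⟨h', hh'⟩ := LinearMap.exists_comp_eq_of_ker_le d.surjective_rangeRestrict (f ∘ₗ h)
    fun x hx => by
      rw [LinearMap.ker_rangeRestrict] at hx
      obtain ⟨y, rfl⟩ := (hdd x).mp hx
      simpa using congr_arg f (LinearMap.congr_fun hh y)
  obtain ⟨ψ, hψ⟩ := Module.Injective.out (LinearMap.range d).subtype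
    (Submodule.injective_subtype _) h'
  have hψ' x : ψ (d x) = f (h x) :=
    (hψ (d.rangeRestrict x)).trans (LinearMap.congr_fun hh' x)
  obtain ⟨φ, hφ⟩ := LinearMap.exists_comp_eq_of_ker_le hπ (g ∘ₗ ψ) fun x hx => by
    obtain ⟨y, rfl⟩ := (hdπ x).mp hx
    simp [hψ', hfg.apply_apply_eq_zero]
  have hφ' x : φ (π x) = g (ψ x) := LinearMap.congr_fun hφ x
  obtain ⟨φ', hφφ'⟩ := hs φ
  have hφφ'' x : g (φ' x) = s • φ x := LinearMap.congr_fun hφφ' x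
  obtain ⟨k, hk⟩ := LinearMap.exists_comp_eq_of_forall_mem_range hf (s • ψ - φ' ∘ₗ π) fun x =>
    (hfg _).mp (by simp [hφφ'', hφ'])
  have hk' x : f (k x) = s • ψ x - φ' (π x) := LinearMap.congr_fun hk x
  refine ⟨k, LinearMap.ext fun x => hf ?_⟩
  change f (k (d x)) = f (s • h x)
  simp [hk', hψ', hdπ.apply_apply_eq_zero]

end Ext

section Tensor

variable {R : Type u} [CommRing R] {E B C : Type u} [AddCommGroup E] [Module R E]
  [AddCommGroup B] [Module R B] [AddCommGroup C] [Module R C] {f : E →ₗ[R] B} {g : B →ₗ[R] C}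

theorem TensorProduct.exists_sum_tmul_eq_of_finite {M : Type*} [AddCommGroup M] [Module R M]
    [Module.Finite R M] (x : M ⊗[R] E) :
    ∃ (k : ℕ) (m : Fin k → M) (e : Fin k → E),
      Submodule.span R (Set.range m) = ⊤ ∧ x = ∑ j, m j ⊗ₜ e j := by
  obtain ⟨k, m, e, rfl⟩ := TensorProduct.exists_sum_tmul_eq x
  obtain ⟨l, m', hm'⟩ := Module.Finite.exists_fin (R := R) (M := M)
  refine ⟨k + l, Fin.addCases m m', Fin.addCases e 0, ?_, by simp [Fin.sum_univ_add]⟩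
  rw [eq_top_iff, ← hm', Submodule.span_le]
  rintro _ ⟨i, rfl⟩
  exact Submodule.subset_span ⟨Fin.natAdd k i, by simp⟩

theorem smul_eq_zero_of_lTensor_eq_zero_of_finite (hf : Function.Injective f)
    (hfg : Function.Exact f g) {s : R}
    (hs : ∀ (N : Type u) [AddCommGroup N] [Module R N] [Module.FinitePresentation R N]
      (φ : N →ₗ[R] C), ∃ ψ : N →ₗ[R] B, g ∘ₗ ψ = s • φ)
    {M : Type*} [AddCommGroup M] [Module R M] [Module.Finite R M] {x : M ⊗[R] E}
    (hx : f.lTensor M x = 0) : s • x = 0 := by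
  obtain ⟨l, m, e, hm, rfl⟩ := TensorProduct.exists_sum_tmul_eq_of_finite x
  obtain ⟨k, a, b, hab, ham⟩ := TensorProduct.vanishesTrivially_of_sum_tmul_eq_zero R
    (m := m) (n := f ∘ e) hm (by simpa using hx)
  let K := Submodule.span R (Set.range a)
  have : Module.FinitePresentation R ((Fin k → R) ⧸ K) :=
    Module.finitePresentation_of_surjective K.mkQ K.mkQ_surjective (by
      rw [Submodule.ker_mkQ]
      exact Submodule.fg_span (Set.finite_range a))
  have hφ : K ≤ LinearMap.ker (Fintype.linearCombination R (g ∘ b)) := by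
    rw [Submodule.span_le]
    rintro _ ⟨j, rfl⟩
    have := congr_arg g (hab j)
    simp only [Function.comp_apply, hfg.apply_apply_eq_zero, map_sum, map_smul] at this
    simp [Fintype.linearCombination_apply, ← this]
  obtain ⟨ψ, hψ⟩ := hs _ (K.liftQ _ hφ)
  let b' := fun i => ψ (K.mkQ (Pi.single i 1))
  have hb' i : g (b' i) = s • g (b i) := by
    simpa [b'] using LinearMap.congr_fun hψ (K.mkQ (Pi.single i 1))
  have hab' j : ∑ i, a j i • b' i = 0 := by
    have h₁ : K.mkQ (a j) = 0 := by
      simpa using Submodule.subset_span (Set.mem_range_self j)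
    rw [pi_eq_sum_univ' (a j)] at h₁
    have h₂ := congr_arg ψ h₁
    simpa only [map_sum, map_smul, map_zero] using h₂
  have hy i : ∃ y, f y = s • b i - b' i := (hfg _).mp (by simp [hb'])
  choose y hy using hy
  have hey j : s • e j = ∑ i, a j i • y i := hf <| by
    have := hab j
    simp only [Function.comp_apply] at this
    simp [hy, this, smul_sub, hab', Finset.smul_sum, smul_comm s]
  rw [Finset.smul_sum]
  simp_rw [← TensorProduct.tmul_smul, hey]
  refine TensorProduct.sum_tmul_eq_zero_of_vanishesTrivially R ⟨k, a, y, fun _ => rfl, ham⟩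

theorem smul_eq_zero_of_lTensor_eq_zero (hf : Function.Injective f)
    (hfg : Function.Exact f g) {s : R}
    (hs : ∀ (N : Type u) [AddCommGroup N] [Module R N] [Module.FinitePresentation R N]
      (φ : N →ₗ[R] C), ∃ ψ : N →ₗ[R] B, g ∘ₗ ψ = s • φ)
    {M : Type*} [AddCommGroup M] [Module R M] {x : M ⊗[R] E}
    (hx : f.lTensor M x = 0) : s • x = 0 := by
  obtain ⟨J, hJ, y, rfl⟩ := Submodule.exists_fg_le_eq_rTensor_subtype x
  obtain ⟨J', hJ', hJJ', h⟩ := hJ.exists_rTensor_fg_inclusion_eq (x := f.lTensor J y) (y := 0) (by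
    rw [map_zero, ← hx, ← LinearMap.comp_apply, ← LinearMap.comp_apply,
      LinearMap.rTensor_comp_lTensor, LinearMap.lTensor_comp_rTensor])
  have : Module.Finite R J' := Module.Finite.iff_fg.mpr hJ'
  have h₁ : s • (J.inclusion hJJ').rTensor E y = 0 :=
    smul_eq_zero_of_lTensor_eq_zero_of_finite hf hfg hs (by
      rw [map_zero] at h
      rw [← h, ← LinearMap.comp_apply, ← LinearMap.comp_apply,
        LinearMap.rTensor_comp_lTensor, LinearMap.lTensor_comp_rTensor])
  have h₂ := congr_arg (J'.subtype.rTensor E) h₁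
  rwa [map_smul, map_zero, ← LinearMap.comp_apply, ← LinearMap.rTensor_comp,
    Submodule.subtype_comp_inclusion] at h₂

theorem exists_lift_smul_of_lTensor (hf : Function.Injective f) (hg : Function.Surjective g)
    (hfg : Function.Exact f g) {s : R}
    (hs : ∀ (n : ℕ) (K : Submodule R (Fin n → R)) (x : ((Fin n → R) ⧸ K) ⊗[R] E),
      f.lTensor _ x = 0 → s • x = 0)
    {N : Type*} [AddCommGroup N] [Module R N] [Module.FinitePresentation R N] (φ : N →ₗ[R] C) :
    ∃ ψ : N →ₗ[R] B, g ∘ₗ ψ = s • φ := by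
  obtain ⟨n, m, π, r, hπ, hr⟩ := Module.FinitePresentation.exists_fin' R N
  obtain ⟨θ, hθ⟩ := Module.projective_lifting_property g (φ ∘ₗ π) hg
  have hθ' x : g (θ x) = φ (π x) := LinearMap.congr_fun hθ x
  obtain ⟨e, he⟩ := LinearMap.exists_comp_eq_of_forall_mem_range hf (θ ∘ₗ r) fun x =>
    (hfg _).mp (by simp [hθ', hr.apply_apply_eq_zero])
  have he' x : f (e x) = θ (r x) := LinearMap.congr_fun he x
  let A : Matrix (Fin m) (Fin n) R := fun j i => r (Pi.single j 1) i
  have hA j : r (Pi.single j 1) = ∑ i, A j i • Pi.single i 1 := pi_eq_sum_univ' _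
  let K := LinearMap.range A.mulVecLin
  let ε : Fin m → (Fin m → R) ⧸ K := fun j => K.mkQ (Pi.single j 1)
  have hε (v : Fin m → R) : K.mkQ v = ∑ j, v j • ε j := by
    conv_lhs => rw [pi_eq_sum_univ' v]
    simp only [map_sum, map_smul, ε]
  have hAε i : ∑ j, A j i • ε j = 0 := by
    rw [← hε (fun j => A j i), Submodule.mkQ_apply, Submodule.Quotient.mk_eq_zero]
    exact ⟨Pi.single i 1, by ext; simp⟩
  have hspan : Submodule.span R (Set.range ε) = ⊤ := by
    refine eq_top_iff.mpr fun x _ => ?_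
    obtain ⟨v, rfl⟩ := K.mkQ_surjective x
    rw [hε]
    exact Submodule.sum_mem _ fun j _ =>
      Submodule.smul_mem _ _ (Submodule.subset_span ⟨j, rfl⟩)
  have hzero := hs m K (∑ j, ε j ⊗ₜ e (Pi.single j 1)) <| by
    rw [map_sum]
    simp_rw [LinearMap.lTensor_tmul]
    exact TensorProduct.sum_tmul_eq_zero_of_vanishesTrivially R
      ⟨n, A, fun i => θ (Pi.single i 1), fun j => by simp only [he', hA, map_sum, map_smul],
        hAε⟩
  simp_rw [Finset.smul_sum, ← TensorProduct.tmul_smul] at hzero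
  obtain ⟨p, b, z, hbz, hb⟩ := TensorProduct.vanishesTrivially_of_sum_tmul_eq_zero R hspan hzero
  have hc k : ∃ c, A.mulVec c = fun j => b j k := by
    have := hb k
    rwa [← hε (fun j => b j k), Submodule.mkQ_apply, Submodule.Quotient.mk_eq_zero] at this
  choose c hc using hc
  let y : (Fin n → R) →ₗ[R] E := Fintype.linearCombination R fun i => ∑ k, c k i • z k
  have hy : y ∘ₗ r = s • e := by
    refine LinearMap.pi_ext' fun j => LinearMap.ext_ring ?_
    change y (r (Pi.single j 1)) = s • e (Pi.single j 1)
    rw [show s • e (Pi.single j 1) = _ from hbz j, Fintype.linearCombination_apply]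
    simp_rw [Finset.smul_sum, smul_smul]
    rw [Finset.sum_comm]
    refine Finset.sum_congr rfl fun k _ => ?_
    rw [← Finset.sum_smul]
    exact congr_arg (· • z k) (congr_fun (hc k) j)
  obtain ⟨ψ, hψ⟩ := LinearMap.exists_comp_eq_of_ker_le hπ (s • θ - f ∘ₗ y) fun x hx => by
    obtain ⟨v, rfl⟩ := (hr x).mp hx
    have : y (r v) = s • e v := LinearMap.congr_fun hy v
    simp [this, he']
  refine ⟨ψ, LinearMap.ext fun t => ?_⟩
  obtain ⟨x, rfl⟩ := hπ t
  have hψ' : ψ (π x) = s • θ x - f (y x) := LinearMap.congr_fun hψ x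
  simp [hψ', hθ', hfg.apply_apply_eq_zero]

theorem DirectSum.smul_eq_zero_of_forall_lTensor_eq_zero {ι : Type*} (M : ι → Type*)
    [∀ i, AddCommGroup (M i)] [∀ i, Module R (M i)] {s : R}
    (hs : ∀ x : (DirectSum ι M) ⊗[R] E, f.lTensor _ x = 0 → s • x = 0) (i : ι)
    (x : M i ⊗[R] E) (hx : f.lTensor _ x = 0) : s • x = 0 := by
  classical
  have h₁ := hs ((DirectSum.lof R ι M i).rTensor E x) (by
    rw [← LinearMap.comp_apply, LinearMap.lTensor_comp_rTensor, ← LinearMap.rTensor_comp_lTensor,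
      LinearMap.comp_apply, hx, map_zero])
  have h₂ := congr_arg ((DirectSum.component R ι M i).rTensor E) h₁
  have h₃ : DirectSum.component R ι M i ∘ₗ DirectSum.lof R ι M i = LinearMap.id :=
    LinearMap.ext fun x => DirectSum.component.lof_self R i x
  rwa [map_smul, map_zero, ← LinearMap.comp_apply, ← LinearMap.rTensor_comp, h₃,
    LinearMap.rTensor_id, LinearMap.id_apply] at h₂

end Tensor

theorem Module.exists_injective_linearMap_to_injective (R : Type u) [CommRing R] (E : Type u)
    [AddCommGroup E] [Module R E] :
    ∃ (I : Type u) (_ : AddCommGroup I) (_ : Module R I) (f : E →ₗ[R] I),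
      Module.Injective R I ∧ Function.Injective f := by
  let J := Injective.under (ModuleCat.of R E)
  have : CategoryTheory.Injective (ModuleCat.of R J) :=
    inferInstanceAs (CategoryTheory.Injective (Injective.under (ModuleCat.of R E)))
  exact ⟨J, inferInstance, inferInstance, (Injective.ι (ModuleCat.of R E)).hom,
    Module.injective_module_of_injective_object R J, (ModuleCat.mono_iff_injective _).mp
      inferInstance⟩

/-- Every short exact sequence `0 → E → B → C → 0` beginning with `E` is `u`-`S`-pure if
and only if there exists `s ∈ S` with `s • Ext¹_R(N, E) = 0` for every finitely
presented `R`-module `N`. -/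
theorem uS_absolutelyPure_iff_ext_fp
    (R : Type u) [CommRing R] (S : Submonoid R)
    (E : Type u) [AddCommGroup E] [Module R E] :
    (∀ (B C : Type u) (_ : AddCommGroup B) (_ : Module R B)
        (_ : AddCommGroup C) (_ : Module R C) (f : E →ₗ[R] B) (g : B →ₗ[R] C),
        Function.Injective f → Function.Surjective g → Function.Exact f g →
        IsUSPure R S f g) ↔
    (∃ s ∈ S, ∀ (N : Type u) (_ : AddCommGroup N) (_ : Module R N),
        Module.FinitePresentation R N →
        ∀ x : extMod R 1 (ModuleCat.of R N) (ModuleCat.of R E), s • x = 0) := by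
  constructor
  · intro h
    obtain ⟨I, _, _, f, hI, hf⟩ := Module.exists_injective_linearMap_to_injective R E
    let g := (LinearMap.range f).mkQ
    have hg : Function.Surjective g := Submodule.mkQ_surjective _
    have hfg : Function.Exact f g := LinearMap.exact_map_mkQ_range f
    let M : (Σ n : ℕ, Submodule R (Fin n → R)) → Type u := fun i => (Fin i.1 → R) ⧸ i.2
    obtain ⟨⟨s, hs, hsM⟩, -⟩ := h I _ _ _ _ _ f g hf hg hfg (DirectSum _ M)
    refine ⟨s, hs, fun N _ _ _ => smul_extMod_one_eq_zero_of_exists_lift_smul hf hfg ?_⟩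
    exact exists_lift_smul_of_lTensor hf hg hfg fun n K =>
      DirectSum.smul_eq_zero_of_forall_lTensor_eq_zero M hsM ⟨n, K⟩
  · rintro ⟨s, hs, h⟩ B C _ _ _ _ f g hf hg hfg M _ _
    have hM := lTensor_exact M hfg hg
    refine ⟨⟨s, hs, fun x => smul_eq_zero_of_lTensor_eq_zero hf hfg fun N _ _ _ =>
        exists_lift_smul_of_smul_extMod_one_eq_zero hf hg hfg (h N _ _ inferInstance)⟩,
      ⟨1, one_mem S, fun x hx => by simpa using! (hM x).mp hx,
        fun x hx => by simpa using! (hM x).mpr hx⟩,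
      ⟨1, one_mem S, fun y => ?_⟩⟩
    obtain ⟨x, rfl⟩ := LinearMap.lTensor_surjective M hg y
    exact ⟨x, one_smul R _⟩
end
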